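/- arXiv:1401.3035 — 5 statements merged into one kernel-verified Lean document; each statement's English description precedes it below -/
import Mathlib

section
/- Let α be a type, let M be a finite set of finite subsets of α, and let ε assign to each C ∈ M a sign ε(C) ∈ {1, -1}. Suppose that every element of α belongs to an even number of members of M, and that the number of C ∈ M with ε(C) = -1 is odd. Then there exists no function μ : α → ℤ with μ(a) ∈ {1, -1} for all a such that ∏_{a ∈ C} μ(a) = ε(C) for every C ∈ M. -/
open scoped Classical

/-- A finite product of signs is determined by the number of factors equal to `-1`. -/
theorem Finset.prod_eq_neg_one_pow_card_filter {ι : Type*} (s : Finset ι) (f : ι → ℤ)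
    (hf : ∀ i ∈ s, f i = 1 ∨ f i = -1) :
    ∏ i ∈ s, f i = (-1) ^ (s.filter fun i => f i = -1).card := by
  rw [← Finset.prod_const, Finset.prod_filter]
  refine Finset.prod_congr rfl fun i hi => ?_
  rcases hf i hi with h | h <;> simp [h]

/-- Double counting: a product over the members of a finite family of finite sets is a product
over the points, each raised to the number of members containing it. -/
theorem Finset.prod_prod_eq_prod_pow_card_filter_mem {α R : Type*} [CommMonoid R]
    (M : Finset (Finset α)) (f : α → R) :
    ∏ C ∈ M, ∏ a ∈ C, f a =
      ∏ a ∈ M.biUnion id, f a ^ (M.filter fun C => a ∈ C).card := by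
  simp_rw [← Finset.prod_const]
  refine Finset.prod_comm' fun C a => ?_
  simp only [Finset.mem_filter, Finset.mem_biUnion, id]
  exact ⟨fun h => ⟨h, C, h⟩, fun h => h.1⟩

/-- Combinatorial core of parity proofs: if every element of `α` lies in an even number
of members of `M` and an odd number of members `C` of `M` carry sign `ε C = -1`, then
there is no `±1`-valued assignment `μ` on `α` whose product over each `C ∈ M` equals
`ε C`. -/
theorem no_noncontextual_assignment {α : Type*} (M : Finset (Finset α))
    (ε : Finset α → ℤ) (hε : ∀ C ∈ M, ε C = 1 ∨ ε C = -1)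
    (heven : ∀ a : α, Even ((M.filter fun C => a ∈ C).card))
    (hodd : Odd ((M.filter fun C => ε C = -1).card)) :
    ¬ ∃ μ : α → ℤ, (∀ a : α, μ a = 1 ∨ μ a = -1) ∧
      ∀ C ∈ M, (∏ a ∈ C, μ a) = ε C := by
  rintro ⟨μ, hμ, hM⟩
  have h := Finset.prod_prod_eq_prod_pow_card_filter_mem M μ
  rw [Finset.prod_congr rfl hM, Finset.prod_eq_neg_one_pow_card_filter M ε hε,
    hodd.neg_one_pow, Finset.prod_eq_one fun a _ => ?_] at h
  · norm_num at h
  · rcases hμ a with ha | ha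
    · rw [ha, one_pow]
    · rw [ha, (heven a).neg_one_pow]
end

section
/- Pasch configuration produces no parity proof: let O : {1,…,6} → d×d complex matrices satisfy O(p)² = I for every p, and consider the four blocks b₁ = {1,2,3}, b₂ = {1,4,5}, b₃ = {2,4,6}, b₄ = {3,5,6}. Suppose that for each block the three assigned matrices pairwise commute and their product P(bᵢ) equals I or -I. Then ∏_{i=1}^{4} P(bᵢ) = I; in particular the number of blocks with product -I is even, so this assignment is never a parity proof of the Kochen–Specker theorem. -/
open scoped Classical

/-- In a monoid, a commuting pair of involutions has an involutive product. -/
theorem mul_mul_mul_self_eq_one_of_commute {M : Type*} [Monoid M] {x y : M}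
    (hx : x * x = 1) (hy : y * y = 1) (h : Commute x y) : (x * y) * (x * y) = 1 := by
  rw [h.symm.mul_mul_mul_comm, hx, hy, one_mul]

/-- The third of three factors is recovered from their product when the first two are
commuting involutions. -/
theorem eq_mul_mul_of_commute_involutions {M : Type*} [Monoid M] {x y z p : M}
    (hx : x * x = 1) (hy : y * y = 1) (h : Commute x y) (hp : p = x * y * z) :
    z = x * y * p := by
  rw [hp, ← mul_assoc, mul_mul_mul_self_eq_one_of_commute hx hy h, one_mul]

/-- The Pasch configuration produces no parity proof: for any assignment of matrices
squaring to `I` to its six points such that each of the four blocks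
`{1,2,3}, {1,4,5}, {2,4,6}, {3,5,6}` consists of pairwise commuting matrices with
product `±I`, the product of the four block products is `I`; in particular the number
of blocks with product `-I` is even. -/
theorem pasch_no_parity_proof {d : ℕ} (O : Fin 6 → Matrix (Fin d) (Fin d) ℂ)
    (hsq : ∀ p, O p * O p = 1)
    (P : Fin 4 → Matrix (Fin d) (Fin d) ℂ)
    (hP0 : P 0 = O 0 * O 1 * O 2) (hP1 : P 1 = O 0 * O 3 * O 4)
    (hP2 : P 2 = O 1 * O 3 * O 5) (hP3 : P 3 = O 2 * O 4 * O 5)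
    (hb1 : Commute (O 0) (O 1) ∧ Commute (O 0) (O 2) ∧ Commute (O 1) (O 2))
    (hb2 : Commute (O 0) (O 3) ∧ Commute (O 0) (O 4) ∧ Commute (O 3) (O 4))
    (hb3 : Commute (O 1) (O 3) ∧ Commute (O 1) (O 5) ∧ Commute (O 3) (O 5))
    (hb4 : Commute (O 2) (O 4) ∧ Commute (O 2) (O 5) ∧ Commute (O 4) (O 5))
    (hpm : ∀ i, P i = 1 ∨ P i = -1) :
    P 0 * P 1 * P 2 * P 3 = 1 ∧
      Even ((Finset.univ.filter fun i : Fin 4 => P i = -1).card) := by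
  have h2 := eq_mul_mul_of_commute_involutions (hsq 0) (hsq 1) hb1.1 hP0
  have h4 := eq_mul_mul_of_commute_involutions (hsq 0) (hsq 3) hb2.1 hP1
  have h5 := eq_mul_mul_of_commute_involutions (hsq 1) (hsq 3) hb3.1 hP2
  have hcancel : O 0 * O 1 * (O 0 * O 3) * (O 1 * O 3) = 1 := by
    rw [hb1.1.symm.mul_mul_mul_comm, hsq 0, one_mul,
      mul_mul_mul_self_eq_one_of_commute (hsq 1) (hsq 3) hb3.1]
  have hP3' : P 3 = P 0 * P 1 * P 2 := by
    rw [hP3, h2, h4, h5]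
    rcases hpm 0 with e0 | e0 <;> rcases hpm 1 with e1 | e1 <;>
      rcases hpm 2 with e2 | e2 <;> simp [e0, e1, e2, hcancel]
  refine ⟨?_, ?_⟩
  · rw [hP3']
    rcases hpm 0 with e0 | e0 <;> rcases hpm 1 with e1 | e1 <;>
      rcases hpm 2 with e2 | e2 <;> simp [e0, e1, e2]
  · rw [Finset.card_filter, Fin.sum_univ_four, hP3']
    by_cases h : (1 : Matrix (Fin d) (Fin d) ℂ) = -1
    · rcases hpm 0 with e0 | e0 <;> rcases hpm 1 with e1 | e1 <;>
        rcases hpm 2 with e2 | e2 <;> simp [e0, e1, e2, ← h] <;> decide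
    · rcases hpm 0 with e0 | e0 <;> rcases hpm 1 with e1 | e1 <;>
        rcases hpm 2 with e2 | e2 <;> simp [e0, e1, e2, h] <;> decide
end

section
/- The C2 (triangular prism) configuration produces no parity proof: let O : {1,…,9} → d×d complex matrices satisfy O(p)² = I for every p, and consider the six blocks b₁ = {1,3,7}, b₂ = {1,2,8}, b₃ = {2,3,9}, b₄ = {4,6,7}, b₅ = {4,5,8}, b₆ = {5,6,9} (points 1,2,3 are the edges of one triangle of the prism, points 4,5,6 the edges of the other triangle, and points 7,8,9 the three rungs). Suppose that for each block the three assigned matrices pairwise commute and their product P(bᵢ) equals I or -I. Then ∏_{i=1}^{6} P(bᵢ) = I; in particular the number of blocks with product -I is even, so this assignment is never a parity proof of the Kochen–Specker theorem. -/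
open scoped Classical

/-- Three involutions `a`, `b`, `c`, with `b` commuting with `a` and `c`, completed by
`x`, `y`, `z` to blocks with products `p`, `q`, `r` equal to `±1`:
then `x * y * z` is the product of the block products. -/
theorem triangle_rungs_mul {R : Type*} [Ring R] {a b c x y z p q r : R}
    (ha : a * a = 1) (hb : b * b = 1) (hc : c * c = 1)
    (hab : Commute a b) (hbc : Commute b c)
    (hp : p = a * c * x) (hq : q = a * b * y) (hr : r = b * c * z)
    (hp' : p = 1 ∨ p = -1) (hq' : q = 1 ∨ q = -1) (hr' : r = 1 ∨ r = -1) :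
    x * y * z = p * q * r := by
  have key {u v w t : R} (hu : u * u = 1) (hv : v * v = 1) (ht : t = u * v * w) :
      w = v * u * t := by
    rw [ht]
    calc w = v * (u * u) * v * w := by rw [hu, mul_one, hv, one_mul]
      _ = v * u * (u * v * w) := by simp only [mul_assoc]
  have hcab : c * a * (b * a) * (c * b) = 1 := by
    calc c * a * (b * a) * (c * b) = c * (a * a) * b * (c * b) := by
          rw [← hab.eq]; simp only [mul_assoc]
      _ = c * b * (b * c) := by rw [ha, mul_one, ← hbc.eq]
      _ = c * (b * b) * c := by simp only [mul_assoc]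
      _ = 1 := by rw [hb, mul_one, hc]
  have hx := key ha hc hp
  have hy := key ha hb hq
  have hz := key hb hc hr
  clear hp hq hr
  rw [hx, hy, hz]
  rcases hp' with rfl | rfl <;> rcases hq' with rfl | rfl <;> rcases hr' with rfl | rfl <;>
    simp [hcab]

/-- If the product of six signs is `1`, evenly many of them are `-1`. -/
theorem even_card_neg_one_of_mul_eq_one {R : Type*} [Ring R] [DecidableEq R]
    (P : Fin 6 → R) (hpm : ∀ i, P i = 1 ∨ P i = -1) (h : P 0 * P 1 * P 2 * P 3 * P 4 * P 5 = 1) :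
    Even ((Finset.univ.filter fun i : Fin 6 => P i = -1).card) := by
  by_cases h1 : (-1 : R) = 1
  · have hall (i : Fin 6) : P i = -1 := (hpm i).elim (fun hi => hi.trans h1.symm) id
    simp only [hall, Finset.filter_true, Finset.card_univ, Fintype.card_fin]
    decide
  · have hpow (i : Fin 6) : (-1 : R) ^ (if P i = -1 then 1 else 0) = P i := by
      split_ifs with hi
      · rw [pow_one, hi]
      · rw [pow_zero, (hpm i).resolve_right hi]
    have hcard : (-1 : R) ^ (Finset.univ.filter fun i : Fin 6 => P i = -1).card = 1 := by
      rw [Finset.card_filter, Fin.sum_univ_six]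
      simp only [pow_add, hpow, h]
    exact (neg_one_pow_eq_one_iff_even h1).mp hcard

/-- The C2 (triangular prism) configuration produces no parity proof: for any assignment
of matrices squaring to `I` to its nine points (points `1,2,3` the edges of one triangle,
`4,5,6` the edges of the other triangle, `7,8,9` the rungs) such that each of the six
blocks `{1,3,7}, {1,2,8}, {2,3,9}, {4,6,7}, {4,5,8}, {5,6,9}` consists of pairwise
commuting matrices with product `±I`, the product of the six block products is `I`;
in particular the number of blocks with product `-I` is even. -/
theorem prism_no_parity_proof {d : ℕ} (O : Fin 9 → Matrix (Fin d) (Fin d) ℂ)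
    (hsq : ∀ p, O p * O p = 1)
    (P : Fin 6 → Matrix (Fin d) (Fin d) ℂ)
    (hP0 : P 0 = O 0 * O 2 * O 6) (hP1 : P 1 = O 0 * O 1 * O 7)
    (hP2 : P 2 = O 1 * O 2 * O 8) (hP3 : P 3 = O 3 * O 5 * O 6)
    (hP4 : P 4 = O 3 * O 4 * O 7) (hP5 : P 5 = O 4 * O 5 * O 8)
    (hb1 : Commute (O 0) (O 2) ∧ Commute (O 0) (O 6) ∧ Commute (O 2) (O 6))
    (hb2 : Commute (O 0) (O 1) ∧ Commute (O 0) (O 7) ∧ Commute (O 1) (O 7))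
    (hb3 : Commute (O 1) (O 2) ∧ Commute (O 1) (O 8) ∧ Commute (O 2) (O 8))
    (hb4 : Commute (O 3) (O 5) ∧ Commute (O 3) (O 6) ∧ Commute (O 5) (O 6))
    (hb5 : Commute (O 3) (O 4) ∧ Commute (O 3) (O 7) ∧ Commute (O 4) (O 7))
    (hb6 : Commute (O 4) (O 5) ∧ Commute (O 4) (O 8) ∧ Commute (O 5) (O 8))
    (hpm : ∀ i, P i = 1 ∨ P i = -1) :
    P 0 * P 1 * P 2 * P 3 * P 4 * P 5 = 1 ∧
      Even ((Finset.univ.filter fun i : Fin 6 => P i = -1).card) := by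
  have hleft := triangle_rungs_mul (hsq 0) (hsq 1) (hsq 2) hb2.1 hb3.1 hP0 hP1 hP2
    (hpm 0) (hpm 1) (hpm 2)
  have hright := triangle_rungs_mul (hsq 3) (hsq 4) (hsq 5) hb5.1 hb6.1 hP3 hP4 hP5
    (hpm 3) (hpm 4) (hpm 5)
  have hprod : P 0 * P 1 * P 2 * P 3 * P 4 * P 5 = 1 := by
    rw [mul_assoc (P 0 * P 1 * P 2 * P 3), mul_assoc (P 0 * P 1 * P 2), ← mul_assoc (P 3),
      ← hright, hleft]
    rcases hpm 0 with h0 | h0 <;> rcases hpm 1 with h1 | h1 <;> rcases hpm 2 with h2 | h2 <;>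
      simp [h0, h1, h2]
  exact ⟨hprod, even_card_neg_one_of_mul_eq_one P hpm hprod⟩
end

section
/- C3 grid identity: let O₁, O₂, O₃, O₄ be d×d complex matrices with Oᵢ² = I for all i, and let s₁,…,s₅ ∈ {1,-1}. Populate the 3×3 grid with A₁₁ = O₁, A₁₂ = O₂, A₁₃ = s₁O₁O₂, A₂₁ = O₃, A₂₂ = O₄, A₂₃ = s₂O₃O₄, A₃₁ = s₃O₁O₃, A₃₂ = s₄O₂O₄, A₃₃ = s₅O₁O₂O₃O₄. Assume (O₁O₂O₃O₄)² = I, that O₁O₂ = O₂O₁, O₃O₄ = O₄O₃, O₁O₃ = O₃O₁, O₂O₄ = O₄O₂, and that within each of the six blocks (the three rows and three columns of the grid) the three entries pairwise commute. Then the product of the six block products, ∏_{rows i} A_{i1}A_{i2}A_{i3} · ∏_{columns j} A_{1j}A_{2j}A_{3j}, equals (O₁O₄)². -/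
/-- C3 grid identity: for the parametrized assignment of observables to the 3×3 grid
(whose six blocks are the three rows and three columns), the product of the six block
products equals `(O₁O₄)²`. -/
theorem c3_grid_identity {d : ℕ} (O₁ O₂ O₃ O₄ : Matrix (Fin d) (Fin d) ℂ)
    (s : Fin 5 → ℂ) (hs : ∀ i, s i = 1 ∨ s i = -1)
    (hsq₁ : O₁ * O₁ = 1) (hsq₂ : O₂ * O₂ = 1) (hsq₃ : O₃ * O₃ = 1) (hsq₄ : O₄ * O₄ = 1)
    (A : Fin 3 → Fin 3 → Matrix (Fin d) (Fin d) ℂ)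
    (hA00 : A 0 0 = O₁) (hA01 : A 0 1 = O₂) (hA02 : A 0 2 = s 0 • (O₁ * O₂))
    (hA10 : A 1 0 = O₃) (hA11 : A 1 1 = O₄) (hA12 : A 1 2 = s 1 • (O₃ * O₄))
    (hA20 : A 2 0 = s 2 • (O₁ * O₃)) (hA21 : A 2 1 = s 3 • (O₂ * O₄))
    (hA22 : A 2 2 = s 4 • (O₁ * O₂ * O₃ * O₄))
    (hbig : (O₁ * O₂ * O₃ * O₄) * (O₁ * O₂ * O₃ * O₄) = 1)
    (h12 : Commute O₁ O₂) (h34 : Commute O₃ O₄)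
    (h13 : Commute O₁ O₃) (h24 : Commute O₂ O₄)
    (hrow : ∀ i j j' : Fin 3, Commute (A i j) (A i j'))
    (hcol : ∀ j i i' : Fin 3, Commute (A i j) (A i' j)) :
    (A 0 0 * A 0 1 * A 0 2) * (A 1 0 * A 1 1 * A 1 2) * (A 2 0 * A 2 1 * A 2 2) *
      ((A 0 0 * A 1 0 * A 2 0) * (A 0 1 * A 1 1 * A 2 1) * (A 0 2 * A 1 2 * A 2 2)) =
      (O₁ * O₄) ^ 2 := by
  have hs2 : ∀ i, s i * s i = 1 := fun i => by rcases hs i with h | h <;> simp [h]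
  have hs0 : ∀ i, s i ≠ 0 := fun i h => by simpa [h] using hs2 i
  have cancel : ∀ (i j : Fin 5) (X Y : Matrix (Fin d) (Fin d) ℂ),
      Commute (s i • X) (s j • Y) → X * Y = Y * X := fun i j X Y h =>
    ((Commute.smul_right_iff₀ (hs0 j)).1 ((Commute.smul_left_iff₀ (hs0 i)).1 h)).eq
  have hthirdCol : O₁ * O₂ * (O₃ * O₄) = O₃ * O₄ * (O₁ * O₂) :=
    cancel 0 1 _ _ (hA02 ▸ hA12 ▸ hcol 2 0 1)
  have hthirdRow : O₂ * O₄ * (O₁ * O₂ * O₃ * O₄) = O₁ * O₂ * O₃ * O₄ * (O₂ * O₄) :=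
    cancel 3 4 _ _ (hA21 ▸ hA22 ▸ hrow 2 1 2)
  have square_mul : ∀ {X Y : Matrix (Fin d) (Fin d) ℂ}, X * X = 1 → Y * Y = 1 → Commute X Y →
      X * Y * (X * Y) = 1 := fun hX hY h => by
    rw [h.symm.mul_mul_mul_comm, hX, hY, one_mul]
  have hrow₃ : O₁ * O₃ * (O₂ * O₄) * (O₁ * O₂ * O₃ * O₄) = (O₁ * O₄) ^ 2 := calc
    _ = O₁ * O₃ * (O₁ * O₂ * (O₃ * O₄)) * (O₂ * O₄) := by
      rw [mul_assoc, hthirdRow]; simp only [mul_assoc]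
    _ = O₁ * (O₃ * O₃) * O₄ * O₁ * (O₂ * O₂) * O₄ := by
      rw [hthirdCol]; simp only [mul_assoc]
    _ = (O₁ * O₄) ^ 2 := by
      rw [hsq₃, hsq₂, sq]; simp only [mul_one, mul_assoc]
  have hcol₃ : O₁ * O₂ * (O₃ * O₄) * (O₁ * O₂ * O₃ * O₄) = 1 := by
    rw [← mul_assoc (O₁ * O₂) O₃ O₄, hbig]
  simp only [hA00, hA01, hA02, hA10, hA11, hA12, hA20, hA21, hA22, smul_mul_assoc,
    mul_smul_comm, smul_smul, square_mul hsq₁ hsq₂ h12, square_mul hsq₃ hsq₄ h34,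
    square_mul hsq₁ hsq₃ h13, square_mul hsq₂ hsq₄ h24, hrow₃, hcol₃, one_mul, mul_one]
  convert one_smul ℂ _ using 2
  linear_combination s 1 * s 1 * s 2 * s 2 * s 3 * s 3 * s 4 * s 4 * hs2 0 +
    s 2 * s 2 * s 3 * s 3 * s 4 * s 4 * hs2 1 + s 3 * s 3 * s 4 * s 4 * hs2 2 +
    s 4 * s 4 * hs2 3 + hs2 4
end

section
/- Mermin square: let I₂, X, Y be the 2×2 matrices I₂ = [[1,0],[0,1]], X = [[0,1],[1,0]], Y = [[0,-i],[i,0]], and define the nine 4×4 matrices via Kronecker products: A₁₁ = X⊗I₂, A₁₂ = I₂⊗X, A₁₃ = X⊗X, A₂₁ = I₂⊗Y, A₂₂ = Y⊗I₂, A₂₃ = Y⊗Y, A₃₁ = X⊗Y, A₃₂ = Y⊗X, A₃₃ = Z⊗Z where Z = [[1,0],[0,-1]]. Then: (a) each A_{ij} is Hermitian and satisfies A_{ij}² = I₄; (b) the three matrices in each row and in each column pairwise commute; (c) A_{i1}A_{i2}A_{i3} = I₄ for each row i, A_{11}A_{21}A_{31} = I₄, A_{12}A_{22}A_{32} = I₄,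 and A_{13}A_{23}A_{33} = -I₄. Hence the six contexts given by the rows and columns form a parity proof of the Kochen–Specker theorem. -/
open Kronecker

namespace MerminSquare

def I₂ : Matrix (Fin 2) (Fin 2) ℂ := !![1, 0; 0, 1]
def X : Matrix (Fin 2) (Fin 2) ℂ := !![0, 1; 1, 0]
def Y : Matrix (Fin 2) (Fin 2) ℂ := !![0, -Complex.I; Complex.I, 0]
def Z : Matrix (Fin 2) (Fin 2) ℂ := !![1, 0; 0, -1]

/-- The nine operators of the Mermin square, indexed by row and column. -/
def A : Fin 3 → Fin 3 → Matrix (Fin 2 × Fin 2) (Fin 2 × Fin 2) ℂ :=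
  ![![X ⊗ₖ I₂, I₂ ⊗ₖ X, X ⊗ₖ X],
    ![I₂ ⊗ₖ Y, Y ⊗ₖ I₂, Y ⊗ₖ Y],
    ![X ⊗ₖ Y, Y ⊗ₖ X, Z ⊗ₖ Z]]

open Matrix

@[simp] lemma I₂_eq_one : I₂ = 1 := by
  ext i j; fin_cases i <;> fin_cases j <;> rfl

@[simp] lemma X_mul_X : X * X = 1 := by
  simp [X, one_fin_two]

@[simp] lemma Y_mul_Y : Y * Y = 1 := by
  simp [Y, one_fin_two]

@[simp] lemma Z_mul_Z : Z * Z = 1 := by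
  simp [Z, one_fin_two]

@[simp] lemma X_mul_Y : X * Y = Complex.I • Z := by
  simp [X, Y, Z]

@[simp] lemma Y_mul_X : Y * X = -Complex.I • Z := by
  simp [X, Y, Z]

@[simp] lemma X_mul_Z : X * Z = -Complex.I • Y := by
  simp [X, Y, Z]

@[simp] lemma Z_mul_X : Z * X = Complex.I • Y := by
  simp [X, Y, Z]

@[simp] lemma Y_mul_Z : Y * Z = Complex.I • X := by
  simp [X, Y, Z]

@[simp] lemma Z_mul_Y : Z * Y = -Complex.I • X := by
  simp [X, Y, Z]

@[simp] lemma conjTranspose_X : Xᴴ = X := by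
  ext i j; fin_cases i <;> fin_cases j <;> simp [X]

@[simp] lemma conjTranspose_Y : Yᴴ = Y := by
  ext i j; fin_cases i <;> fin_cases j <;> simp [Y]

@[simp] lemma conjTranspose_Z : Zᴴ = Z := by
  ext i j; fin_cases i <;> fin_cases j <;> simp [Z]

/-- Mermin square: (a) each of the nine operators is a Hermitian matrix squaring to the
identity; (b) the operators in each row and each column pairwise commute; (c) every row
product and the first two column products equal `I₄`, while the third column product
equals `-I₄`.  Hence the rows and columns form a parity proof of the Kochen–Specker
theorem. -/
theorem mermin_square :
    (∀ i j : Fin 3, (A i j).IsHermitian ∧ A i j * A i j = 1) ∧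
    (∀ i j j' : Fin 3, Commute (A i j) (A i j')) ∧
    (∀ j i i' : Fin 3, Commute (A i j) (A i' j)) ∧
    (∀ i : Fin 3, A i 0 * A i 1 * A i 2 = 1) ∧
    A 0 0 * A 1 0 * A 2 0 = 1 ∧
    A 0 1 * A 1 1 * A 2 1 = 1 ∧
    A 0 2 * A 1 2 * A 2 2 = -1 := by
  refine ⟨fun i j => ⟨?_, ?_⟩, fun i j j' => ?_, fun j i i' => ?_, fun i => ?_, ?_, ?_, ?_⟩
  · fin_cases i <;> fin_cases j <;> simp [A, IsHermitian, conjTranspose_kronecker]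
  · fin_cases i <;> fin_cases j <;> simp [A, ← mul_kronecker_mul]
  · fin_cases i <;> fin_cases j <;> fin_cases j' <;>
      simp [A, commute_iff_eq, ← mul_kronecker_mul, smul_kronecker, kronecker_smul, smul_smul,
        -neg_smul]
  · fin_cases j <;> fin_cases i <;> fin_cases i' <;>
      simp [A, commute_iff_eq, ← mul_kronecker_mul, smul_kronecker, kronecker_smul, smul_smul,
        -neg_smul]
  · fin_cases i <;>
      simp [A, ← mul_kronecker_mul, smul_kronecker, kronecker_smul, smul_smul, -neg_smul]
  · simp [A, ← mul_kronecker_mul]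
  · simp [A, ← mul_kronecker_mul]
  · simp [A, ← mul_kronecker_mul, smul_kronecker, kronecker_smul, smul_smul]

end MerminSquare
end
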